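/- arXiv:1502.03294 — 2 statements merged into one kernel-verified Lean document; each statement's English description precedes it below -/
import Mathlib

section
/- Let I denote the imaginary unit in ℂ, let n ≥ 1 be an integer, and for j ≥ 0 let h(n,j) denote the j-th derivative of the Lucas polynomial L_n (regarded as a function ℂ → ℂ) evaluated at 2I. Then for every integer j with 1 ≤ j ≤ n-1, (n-j)·(n+j) · h(n,j) = 2·(2j+1)·I · h(n,j+1). -/
open Polynomial Complex

/-- The Lucas polynomials: `L 0 = 2`, `L 1 = X`, `L (n+2) = X * L (n+1) + L n`. -/
noncomputable def lucasPoly : ℕ → Polynomial ℤ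
  | 0 => 2
  | 1 => X
  | n + 2 => X * lucasPoly (n + 1) + lucasPoly n

theorem lucas_aux (n : ℕ) :
    (X ^ 2 + 4) * derivative (lucasPoly n) = (n : ℤ[X]) * (2 * lucasPoly (n + 1) - X * lucasPoly n) ∧
    (X ^ 2 + 4) * derivative (lucasPoly (n + 1)) =
      ((n : ℤ[X]) + 1) * (X * lucasPoly (n + 1) + 2 * lucasPoly n) := by
  induction n with
  | zero =>
    constructor
    · have : derivative (2 : ℤ[X]) = 0 := derivative_ofNat 2
      simp [lucasPoly, this]
    · simp [lucasPoly]; ring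
  | succ n ih =>
    obtain ⟨h1, h2⟩ := ih
    have h3 : lucasPoly (n + 1 + 1) = X * lucasPoly (n + 1) + lucasPoly n := by rw [lucasPoly]
    rw [h3]
    push_cast
    constructor
    · linear_combination h2
    · simp only [derivative_add, derivative_mul, derivative_X]
      linear_combination X * h2 + h1

theorem lucas_ode (n : ℕ) :
    (X ^ 2 + 4) * derivative (derivative (lucasPoly n)) + X * derivative (lucasPoly n)
      - (n : ℤ[X]) ^ 2 * lucasPoly n = 0 := by
  obtain ⟨h1, h2⟩ := lucas_aux n
  have hD : (X ^ 2 + 4 : ℤ[X]) ≠ 0 := by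
    intro h
    have := congrArg (eval 0) h
    simp at this
  have h3 := congrArg derivative h1
  have e2 : derivative (2 : ℤ[X]) = 0 := derivative_ofNat 2
  have e4 : derivative (4 : ℤ[X]) = 0 := derivative_ofNat 4
  simp only [derivative_add, derivative_sub, derivative_mul, derivative_X, derivative_X_pow,
    derivative_natCast, e2, e4] at h3
  simp at h3
  apply mul_left_cancel₀ hD
  linear_combination (X ^ 2 + 4) * h3 + 2 * (n : ℤ[X]) * h2 - (X * n + X) * h1

theorem lucas_ode_iter (n j : ℕ) :
    (X ^ 2 + 4) * derivative^[j + 2] (lucasPoly n)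
      + (2 * (j : ℤ[X]) + 1) * X * derivative^[j + 1] (lucasPoly n)
      + ((j : ℤ[X]) ^ 2 - (n : ℤ[X]) ^ 2) * derivative^[j] (lucasPoly n) = 0 := by
  induction j with
  | zero =>
    have := lucas_ode n
    simp
    linear_combination this
  | succ j ih =>
    have h3 := congrArg derivative ih
    have e2 : derivative (2 : ℤ[X]) = 0 := derivative_ofNat 2
    have e4 : derivative (4 : ℤ[X]) = 0 := derivative_ofNat 4
    simp only [derivative_add, derivative_sub, derivative_mul, derivative_X, derivative_X_pow,
      derivative_natCast, e2, e4, derivative_pow, derivative_one, derivative_zero,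
      ← Function.iterate_succ_apply' (⇑derivative)] at h3
    simp only [Nat.succ_eq_add_one] at h3
    simp at h3
    push_cast
    simp only [Function.iterate_succ_apply]
    linear_combination h3

theorem lucas_iter (p : ℤ[X]) (j : ℕ) :
    iteratedDeriv j (fun z : ℂ => (aeval z p : ℂ)) = fun z => aeval z (derivative^[j] p) := by
  induction j with
  | zero => simp
  | succ j ih =>
    rw [iteratedDeriv_succ, ih, Function.iterate_succ_apply']
    funext z
    exact Polynomial.deriv_aeval _

/-- With `h n j` the `j`-th derivative of `L_n` at `2I`, for `1 ≤ j ≤ n - 1` one has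
`(n-j)(n+j) h(n,j) = 2(2j+1) I h(n,j+1)`. -/
theorem lucasPoly_deriv_recurrence (n : ℕ) (hn : 1 ≤ n) (j : ℕ) (hj : 1 ≤ j)
    (hjn : j ≤ n - 1) :
    ((n : ℂ) - j) * ((n : ℂ) + j) *
        iteratedDeriv j (fun z : ℂ => (aeval z (lucasPoly n) : ℂ)) (2 * I) =
      2 * (2 * (j : ℂ) + 1) * I *
        iteratedDeriv (j + 1) (fun z : ℂ => (aeval z (lucasPoly n) : ℂ)) (2 * I) := by
  rw [lucas_iter, lucas_iter]
  have h := congrArg (aeval (2 * I : ℂ)) (lucas_ode_iter n j)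
  have e2 : aeval (2 * I : ℂ) (2 : ℤ[X]) = 2 := map_ofNat _ 2
  have e4 : aeval (2 * I : ℂ) (4 : ℤ[X]) = 4 := map_ofNat _ 4
  simp only [map_add, map_sub, map_mul, map_pow, map_natCast, map_one, map_zero, aeval_X, e2, e4] at h
  linear_combination (-1 : ℂ) * h + 4 * aeval (2 * I) (derivative^[j + 2] (lucasPoly n)) * I_sq
end

section
/- For all positive integers n and m, there exists a polynomial Q with integer coefficients of degree 2m such that L_1 · L_3 ⋯ L_{2m+1} · (∑_{j=1}^{n} L_{2j}^{2m+1}) = (L_{2n+1} - 1) · Q(L_{2n+1}). (Melham's second conjecture, reproved in the paper.) -/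
/-- The Lucas numbers: `L 0 = 2`, `L 1 = 1`, `L (n+2) = L (n+1) + L n`. -/
def lucas : ℕ → ℕ
  | 0 => 2
  | 1 => 1
  | n + 2 => lucas (n + 1) + lucas n

open Polynomial in
/-- The polynomial with `oddPoly k (y - y⁻¹) = y ^ (2k+1) - y⁻¹ ^ (2k+1)`. -/
noncomputable def oddPoly : ℕ → Polynomial ℤ
  | 0 => X
  | 1 => X ^ 3 + 3 * X
  | k + 2 => (X ^ 2 + 2) * oddPoly (k + 1) - oddPoly k

open Polynomial in
theorem oddPoly_deg (k : ℕ) : (oddPoly k).Monic ∧ (oddPoly k).natDegree = 2 * k + 1 := by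
  induction k using Nat.twoStepInduction with
  | zero => simp [oddPoly]
  | one =>
    have h : (X ^ 3 + 3 * X : ℤ[X]).natDegree = 3 := by compute_degree!
    refine ⟨?_, by simpa [oddPoly] using h⟩
    rw [oddPoly]
    monicity!
  | more k ih1 ih2 =>
    obtain ⟨_, d1⟩ := ih1
    obtain ⟨m2, d2⟩ := ih2
    have hm : (X ^ 2 + 2 : ℤ[X]).Monic := by monicity!
    have hd : (X ^ 2 + 2 : ℤ[X]).natDegree = 2 := by compute_degree!
    have hdm : ((X ^ 2 + 2) * oddPoly (k + 1)).natDegree = 2 * (k + 2) + 1 := by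
      rw [hm.natDegree_mul m2, hd, d2]; ring
    have hlt : (oddPoly k).natDegree < ((X ^ 2 + 2) * oddPoly (k + 1)).natDegree := by
      rw [hdm, d1]; omega
    rw [oddPoly]
    refine ⟨(hm.mul m2).sub_of_left (degree_lt_degree hlt), ?_⟩
    rw [natDegree_sub_eq_left_of_natDegree_lt hlt, hdm]

open Polynomial in
theorem oddPoly_aeval (y z : ℝ) (h : y * z = 1) (k : ℕ) :
    aeval (y - z) (oddPoly k) = y ^ (2 * k + 1) - z ^ (2 * k + 1) := by
  induction k using Nat.twoStepInduction with
  | zero => simp [oddPoly]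
  | one =>
    have h3 : aeval (y - z) (3 : ℤ[X]) = 3 := map_ofNat _ 3
    simp [oddPoly, h3]
    linear_combination (-3 * (y - z)) * h
  | more k ih1 ih2 =>
    have e : aeval (y - z) (oddPoly (k + 2)) =
        ((y - z) ^ 2 + 2) * aeval (y - z) (oddPoly (k + 1)) - aeval (y - z) (oddPoly k) := by
      have h3 : aeval (y - z) (2 : ℤ[X]) = 2 := map_ofNat _ 2
      simp [oddPoly, h3]
    rw [e, ih1, ih2]
    linear_combination
      (-2 * (y ^ (2 * (k + 1) + 1) - z ^ (2 * (k + 1) + 1)) + (y * z + 1) *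
        (y ^ (2 * k + 1) - z ^ (2 * k + 1))) * h

theorem odd_pow_expand (u v : ℝ) (h : u * v = 1) (m : ℕ) :
    (u + v) ^ (2 * m + 1) = ∑ k ∈ Finset.range (m + 1),
      ((2 * m + 1).choose (m + 1 + k) : ℝ) * (u ^ (2 * k + 1) + v ^ (2 * k + 1)) := by
  rw [add_pow, show 2 * m + 1 + 1 = (m + 1) + (m + 1) by ring, Finset.sum_range_add,
    ← Finset.sum_range_reflect, ← Finset.sum_add_distrib]
  refine Finset.sum_congr rfl fun k hk => ?_
  have hk' : k ≤ m := by simpa [Nat.lt_succ_iff] using hk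
  obtain ⟨d, rfl⟩ := Nat.exists_eq_add_of_le hk'
  have hc : (2 * (k + d) + 1).choose d = (2 * (k + d) + 1).choose (k + d + 1 + k) := by
    apply Nat.choose_symm_of_eq_add; ring
  have hp : u ^ d * v ^ d = 1 := by rw [← mul_pow, h, one_pow]
  rw [show k + d + 1 - 1 - k = d by omega, hc,
    show 2 * (k + d) + 1 - d = d + (2 * k + 1) by omega,
    show 2 * (k + d) + 1 - (k + d + 1 + k) = d by omega,
    show k + d + 1 + k = d + (2 * k + 1) by omega, pow_add, pow_add]
  linear_combination ((2 * (k + d) + 1).choose (d + (2 * k + 1)) : ℝ) *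
    (u ^ (2 * k + 1) + v ^ (2 * k + 1)) * hp

theorem lucas_binet (n : ℕ) : (lucas n : ℝ) = Real.goldenRatio ^ n + Real.goldenConj ^ n := by
  induction n using Nat.twoStepInduction with
  | zero => norm_num [lucas]
  | one => simp [lucas]
  | more n ih1 ih2 =>
    rw [lucas, Nat.cast_add, ih1, ih2, pow_add _ n 2, pow_add _ n 2, Real.goldenRatio_sq,
      Real.goldenConj_sq]
    ring

theorem golden_mul : Real.goldenRatio * (-Real.goldenConj) = 1 := by
  rw [mul_neg, Real.goldenRatio_mul_goldenConj]; ring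

theorem lucas_even (n : ℕ) :
    (lucas (2 * n) : ℝ) = Real.goldenRatio ^ (2 * n) + (-Real.goldenConj) ^ (2 * n) := by
  rw [lucas_binet, Even.neg_pow (even_two_mul n)]

theorem lucas_odd (n : ℕ) :
    (lucas (2 * n + 1) : ℝ) =
      Real.goldenRatio ^ (2 * n + 1) - (-Real.goldenConj) ^ (2 * n + 1) := by
  rw [lucas_binet, Odd.neg_pow (odd_two_mul_add_one n)]; ring

theorem lucas_pos (n : ℕ) : 0 < lucas n := by
  induction n using Nat.twoStepInduction with
  | zero => simp [lucas]
  | one => simp [lucas]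
  | more n ih1 ih2 => rw [lucas]; omega

open Polynomial in
theorem oddPoly_one (k : ℕ) : (oddPoly k).eval 1 = (lucas (2 * k + 1) : ℤ) := by
  have h := oddPoly_aeval _ _ golden_mul k
  rw [sub_neg_eq_add, Real.goldenRatio_add_goldenConj, ← lucas_odd] at h
  have h2 := aeval_algebraMap_apply ℝ (1 : ℤ) (oddPoly k)
  simp at h2
  rw [h] at h2
  exact_mod_cast h2.symm

/-- Telescoping sum. -/
theorem telescope (y z : ℝ) (h : y * z = 1) (a n : ℕ) :
    (y ^ a - z ^ a) * ∑ j ∈ Finset.Icc 1 n, ((y ^ (2 * j)) ^ a + (z ^ (2 * j)) ^ a) =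
      (y ^ (2 * n + 1)) ^ a - (z ^ (2 * n + 1)) ^ a - (y ^ a - z ^ a) := by
  induction n with
  | zero => simp
  | succ n ih =>
    rw [Finset.sum_Icc_succ_top (by omega), mul_add, ih]
    have hp : y ^ a * z ^ a = 1 := by rw [← mul_pow, h, one_pow]
    have e : ∀ (w : ℝ) (b : ℕ), (w ^ b) ^ a = (w ^ a) ^ b := fun w b => by
      rw [← pow_mul, ← pow_mul, mul_comm]
    simp only [e]
    generalize y ^ a = Y at *
    generalize z ^ a = Z at *
    linear_combination (Z ^ (2 * n + 1) - Y ^ (2 * n + 1)) * hp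

open Polynomial in
/-- The quotient `(oddPoly k - oddPoly k 1) / (X - 1)`. -/
noncomputable def quotPoly (k : ℕ) : Polynomial ℤ := oddPoly k /ₘ (X - C 1)

open Polynomial in
theorem quotPoly_natDegree (k : ℕ) : (quotPoly k).natDegree = 2 * k := by
  rw [quotPoly, natDegree_divByMonic _ (monic_X_sub_C 1), (oddPoly_deg k).2, natDegree_X_sub_C]
  rfl

open Polynomial in
theorem quotPoly_eval (k : ℕ) (x : ℤ) :
    (x - 1) * (quotPoly k).eval x = (oddPoly k).eval x - lucas (2 * k + 1) := by
  have h := congrArg (eval x) (modByMonic_add_div (oddPoly k) (X - C (1 : ℤ)))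
  rw [modByMonic_X_sub_C_eq_C_eval, oddPoly_one] at h
  simp only [eval_add, eval_mul, eval_sub, eval_X, eval_C] at h
  rw [quotPoly]
  linarith

open Polynomial in
/-- Uniform version of the result: `Q` depends on `m` only. -/
theorem melham_uniform (m : ℕ) (hm : 0 < m) :
    ∃ Q : Polynomial ℤ, Q.natDegree = 2 * m ∧ ∀ n : ℕ,
      ((∏ j ∈ Finset.range (m + 1), (lucas (2 * j + 1) : ℤ)) *
        ∑ j ∈ Finset.Icc 1 n, (lucas (2 * j) : ℤ) ^ (2 * m + 1)) =
      ((lucas (2 * n + 1) : ℤ) - 1) * Q.eval (lucas (2 * n + 1) : ℤ) := by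
  set c : ℕ → ℤ := fun k => ((2 * m + 1).choose (m + 1 + k) : ℤ) *
    ∏ j ∈ (Finset.range (m + 1)).erase k, (lucas (2 * j + 1) : ℤ) with hc
  refine ⟨∑ k ∈ Finset.range (m + 1), C (c k) * quotPoly k, ?_, fun n => ?_⟩
  · have hcm : c m ≠ 0 := by
      simp only [hc]
      refine mul_ne_zero ?_ (Finset.prod_ne_zero_iff.2 fun j _ => ?_)
      · exact_mod_cast (Nat.choose_pos (by omega)).ne'
      · exact_mod_cast (lucas_pos _).ne'
    have htop : (C (c m) * quotPoly m).natDegree = 2 * m := by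
      rw [natDegree_C_mul hcm, quotPoly_natDegree]
    have hlow : (∑ k ∈ Finset.range m, C (c k) * quotPoly k).natDegree ≤ 2 * m - 1 := by
      refine natDegree_sum_le_of_forall_le _ _ fun k hk => ?_
      refine (natDegree_C_mul_le _ _).trans ?_
      rw [quotPoly_natDegree]
      have := Finset.mem_range.1 hk
      omega
    rw [Finset.sum_range_succ, natDegree_add_eq_right_of_natDegree_lt (by omega), htop]
  · set x : ℤ := (lucas (2 * n + 1) : ℤ) with hx
    have key : ∀ k, (lucas (2 * k + 1) : ℝ) * ∑ j ∈ Finset.Icc 1 n,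
        ((Real.goldenRatio ^ (2 * j)) ^ (2 * k + 1) +
          ((-Real.goldenConj) ^ (2 * j)) ^ (2 * k + 1)) =
        (((x - 1) * (quotPoly k).eval x : ℤ) : ℝ) := by
      intro k
      have hxr : (x : ℝ) = Real.goldenRatio ^ (2 * n + 1) - (-Real.goldenConj) ^ (2 * n + 1) := by
        rw [← lucas_odd, hx]; simp
      have hyz : Real.goldenRatio ^ (2 * n + 1) * (-Real.goldenConj) ^ (2 * n + 1) = 1 := by
        rw [← mul_pow, golden_mul, one_pow]
      have h2 := aeval_algebraMap_apply ℝ x (oddPoly k)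
      simp only [algebraMap_int_eq, eq_intCast, coe_aeval_eq_eval] at h2
      rw [quotPoly_eval, lucas_odd k, telescope _ _ golden_mul, Int.cast_sub, ← h2, hxr,
        oddPoly_aeval _ _ hyz, Int.cast_natCast, lucas_odd k]
    have hsum : ∑ j ∈ Finset.Icc 1 n, (lucas (2 * j) : ℝ) ^ (2 * m + 1) =
        ∑ k ∈ Finset.range (m + 1), ((2 * m + 1).choose (m + 1 + k) : ℝ) *
          ∑ j ∈ Finset.Icc 1 n, ((Real.goldenRatio ^ (2 * j)) ^ (2 * k + 1) +
          ((-Real.goldenConj) ^ (2 * j)) ^ (2 * k + 1)) := by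
      simp only [Finset.mul_sum]
      rw [Finset.sum_comm]
      refine Finset.sum_congr rfl fun j _ => ?_
      rw [lucas_even, odd_pow_expand]
      rw [← mul_pow, golden_mul, one_pow]
    have goalR : (∏ j ∈ Finset.range (m + 1), (lucas (2 * j + 1) : ℝ)) *
        ∑ j ∈ Finset.Icc 1 n, (lucas (2 * j) : ℝ) ^ (2 * m + 1) =
        (((x - 1) * ∑ k ∈ Finset.range (m + 1), c k * (quotPoly k).eval x : ℤ) : ℝ) := by
      rw [hsum, Finset.mul_sum, Finset.mul_sum, Int.cast_sum]
      refine Finset.sum_congr rfl fun k hk => ?_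
      rw [← Finset.mul_prod_erase _ _ hk, mul_left_comm (x - 1), Int.cast_mul, ← key k]
      simp only [hc]
      push_cast
      ring
    rw [eval_finsetSum]
    simp only [eval_mul, eval_C]
    exact_mod_cast goalR

/-- **Melham's second conjecture.** For all positive integers `n, m`, the number
`L 1 * L 3 * ⋯ * L (2m+1) * ∑_{j=1}^{n} L (2j) ^ (2m+1)` equals
`(L (2n+1) - 1) * Q (L (2n+1))` for some integer polynomial `Q` of degree `2m`. -/
theorem melham_second_conjecture (n m : ℕ) (hn : 0 < n) (hm : 0 < m) :
    ∃ Q : Polynomial ℤ, Q.natDegree = 2 * m ∧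
      ((∏ j ∈ Finset.range (m + 1), (lucas (2 * j + 1) : ℤ)) *
        ∑ j ∈ Finset.Icc 1 n, (lucas (2 * j) : ℤ) ^ (2 * m + 1)) =
      ((lucas (2 * n + 1) : ℤ) - 1) * Q.eval (lucas (2 * n + 1) : ℤ) := by
  obtain ⟨Q, hQ, h⟩ := melham_uniform m hm
  exact ⟨Q, hQ, h n⟩
end
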